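/- (Theorem 5, odd case.) Let n be odd, let T_1(n), \hat{s}_1(n) be as follows: with r_1 = \lfloor C(n,(n-3)/2) 2^{-(n+3)/2} \rfloor, v_1 = \lfloor C(n,(n+1)/2) 2^{-(n+1)/2} \rfloor, z_1 = \lfloor (C(n,(n-1)/2) + r_1 (n+3)/2 - v_1 (n+1)/2)/2 \rfloor, T_1(n) is the set of monotone Boolean functions f of n variables whose minimal ones all lie in E^{n,(n-3)/2}, E^{n,(n-1)/2}, E^{n,(n+1)/2}, with f = 1 on all vectors with at least (n+3)/2 ones, exactly r_1 minimal ones in E^{n,(n-3)/2}, exactly v_1 maximal zeros in E^{n,(n+1)/2}, and value 1 on exactly z_1 vectors of E^{n,(n-1)/2}; P(n) = C(n,(n-1)/2)^{-1}(1/2)(C(n,(n-1)/2) + C(n,(n-3)/2) 2^{-(n+3)/2}(n+3)/2 - C(n,(n+1)/2) 2^{-(n+1)/2}(n+1)/2); \hat{s}_1(n) = n 2^{-n+1}[(1/2)C(n,(n-3)/2)2^{-(n+3)/2} + (1/2)C(n,(n-3)/2)(1-2^{-(n+3)/2})P(n) + (1/2)C(n,(n+1)/2)2^{-(n+1)/2}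 + (1/2)C(n,(n+1)/2)(1-2^{-(n+1)/2})(1-P(n))]. Let T_2(n), \hat{s}_2(n) be defined analogously: with r_2 = \lfloor C(n,(n-1)/2) 2^{-(n+1)/2} \rfloor, v_2 = \lfloor C(n,(n+3)/2) 2^{-(n+3)/2} \rfloor, z_2 = \lfloor (C(n,(n+1)/2) + r_2 (n-1)/2 - v_2 (n+3)/2)/2 \rfloor, T_2(n) consists of monotone f whose minimal ones all lie in E^{n,(n-1)/2}, E^{n,(n+1)/2}, E^{n,(n+3)/2}, with f = 1 on all vectors with at least (n+5)/2 ones, exactly r_2 minimal ones in E^{n,(n-1)/2}, exactly v_2 maximal zeros in E^{n,(n+3)/2}, and value 1 on exactly z_2 vectors of E^{n,(n+1)/2}; Q(n) = C(n,(n+1)/2)^{-1}(1/2)(C(n,(n+1)/2) + C(n,(n-1)/2)2^{-(n+1)/2}(n-1)/2 - C(n,(n+3)/2)2^{-(n+3)/2}(n+3)/2); \hat{s}_2(n) = n 2^{-n+1}[(1/2)C(n,(n-1)/2)2^{-(n+1)/2} + (1/2)C(n,(n-1)/2)(1-2^{-(n+1)/2})Q(n) + (1/2)C(n,(n+3)/2)2^{-(n+3)/2}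 + (1/2)C(n,(n+3)/2)(1-2^{-(n+3)/2})(1-Q(n))]. If f is drawn by first choosing one of T_1(n), T_2(n) with probability 1/2 each and then choosing f uniformly from the chosen set, then the expected average sensitivity \hat{s}(n) = E[s^f] satisfies \hat{s}(n) / ((1/2)(\hat{s}_1(n) + \hat{s}_2(n))) \to 1 as n \to \infty through odd values. -/

import Mathlib

open Finset

/-- `x` with its `j`-th coordinate set to `b`. -/
def setCoord {n : ℕ} (x : Fin n → Bool) (j : Fin n) (b : Bool) : Fin n → Bool :=
  Function.update x j b

/-- `x` with its `j`-th coordinate flipped (`x ⊕ e_j`). -/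
def flipCoord {n : ℕ} (x : Fin n → Bool) (j : Fin n) : Fin n → Bool :=
  Function.update x j (!x j)

/-- Number of ones of a Boolean vector. -/
def weight {n : ℕ} (x : Fin n → Bool) : ℕ :=
  (Finset.univ.filter fun i => x i = true).card

/-- The activity `α_j^f = 2^{-n} ∑_x (f(x^{(j,0)}) ⊕ f(x^{(j,1)}))`. -/
noncomputable def activity {n : ℕ} (f : (Fin n → Bool) → Bool) (j : Fin n) : ℝ :=
  (2 ^ n : ℝ)⁻¹ * ∑ x : Fin n → Bool,
    (if f (setCoord x j false) ≠ f (setCoord x j true) then (1 : ℝ) else 0)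

/-- The sensitivity `s^f(x)` of `f` at `x`. -/
def sensAt {n : ℕ} (f : (Fin n → Bool) → Bool) (x : Fin n → Bool) : ℕ :=
  (Finset.univ.filter fun i => f (flipCoord x i) ≠ f x).card

/-- The average sensitivity `s^f`. -/
noncomputable def avgSens {n : ℕ} (f : (Fin n → Bool) → Bool) : ℝ :=
  (2 ^ n : ℝ)⁻¹ * ∑ x : Fin n → Bool, (sensAt f x : ℝ)

/-- `x` is a minimal one of the (monotone) function `f`. -/
def MinimalOne {n : ℕ} (f : (Fin n → Bool) → Bool) (x : Fin n → Bool) : Prop :=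
  f x = true ∧ ∀ y, y < x → f y = false

/-- `x` is a maximal zero of the (monotone) function `f`. -/
def MaximalZero {n : ℕ} (f : (Fin n → Bool) → Bool) (x : Fin n → Bool) : Prop :=
  f x = false ∧ ∀ y, x < y → f y = true

/-- The expected average sensitivity of a function drawn uniformly from `T`. -/
noncomputable def expAvgSens {n : ℕ} (T : Finset ((Fin n → Bool) → Bool)) : ℝ :=
  (∑ f ∈ T, avgSens f) / T.card

/-- `r_1 = ⌊C(n,(n-3)/2) 2^{-(n+3)/2}⌋` (for odd `n`). -/
def r1 (n : ℕ) : ℕ := n.choose ((n - 3) / 2) / 2 ^ ((n + 3) / 2)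

/-- `v_1 = ⌊C(n,(n+1)/2) 2^{-(n+1)/2}⌋` (for odd `n`). -/
def v1 (n : ℕ) : ℕ := n.choose ((n + 1) / 2) / 2 ^ ((n + 1) / 2)

/-- `z_1 = ⌊(C(n,(n-1)/2) + r_1 (n+3)/2 - v_1 (n+1)/2)/2⌋` (for odd `n`). -/
def z1 (n : ℕ) : ℤ :=
  ⌊((n.choose ((n - 1) / 2) : ℚ) + (r1 n : ℚ) * (((n + 3) / 2 : ℕ) : ℚ) -
      (v1 n : ℚ) * (((n + 1) / 2 : ℕ) : ℚ)) / 2⌋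

open Classical in
/-- The first class of `typical' monotone Boolean functions for odd `n`: minimal ones only
in layers `(n-3)/2, (n-1)/2, (n+1)/2`, value `1` from layer `(n+3)/2` upward, exactly `r_1`
minimal ones in layer `(n-3)/2`, exactly `v_1` maximal zeros in layer `(n+1)/2`, and value
`1` on exactly `z_1` vertices of layer `(n-1)/2`. -/
noncomputable def typicalOdd1 (n : ℕ) : Finset ((Fin n → Bool) → Bool) :=
  Finset.univ.filter fun f =>
    Monotone f ∧
    (∀ x, MinimalOne f x →
      weight x = (n - 3) / 2 ∨ weight x = (n - 1) / 2 ∨ weight x = (n + 1) / 2) ∧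
    (∀ x, (n + 3) / 2 ≤ weight x → f x = true) ∧
    {x : Fin n → Bool | MinimalOne f x ∧ weight x = (n - 3) / 2}.ncard = r1 n ∧
    {x : Fin n → Bool | MaximalZero f x ∧ weight x = (n + 1) / 2}.ncard = v1 n ∧
    ({x : Fin n → Bool | f x = true ∧ weight x = (n - 1) / 2}.ncard : ℤ) = z1 n

/-- The probability `P(n)` that a vertex of layer `(n-1)/2` carries the value `1`. -/
noncomputable def Pprob (n : ℕ) : ℝ :=
  ((n.choose ((n - 1) / 2) : ℝ))⁻¹ *
    ((1 / 2) * ((n.choose ((n - 1) / 2) : ℝ) +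
      (n.choose ((n - 3) / 2) : ℝ) * ((2 : ℝ) ^ ((n + 3) / 2))⁻¹ * (((n : ℝ) + 3) / 2) -
      (n.choose ((n + 1) / 2) : ℝ) * ((2 : ℝ) ^ ((n + 1) / 2))⁻¹ * (((n : ℝ) + 1) / 2)))

/-- `ŝ_1(n)`, the asymptotic expected average sensitivity for the first odd class. -/
noncomputable def s1hat (n : ℕ) : ℝ :=
  (n : ℝ) * (2 : ℝ) ^ (1 - (n : ℤ)) *
    ((1 / 2) * (n.choose ((n - 3) / 2) : ℝ) * ((2 : ℝ) ^ ((n + 3) / 2))⁻¹ +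
     (1 / 2) * (n.choose ((n - 3) / 2) : ℝ) * (1 - ((2 : ℝ) ^ ((n + 3) / 2))⁻¹) * Pprob n +
     (1 / 2) * (n.choose ((n + 1) / 2) : ℝ) * ((2 : ℝ) ^ ((n + 1) / 2))⁻¹ +
     (1 / 2) * (n.choose ((n + 1) / 2) : ℝ) * (1 - ((2 : ℝ) ^ ((n + 1) / 2))⁻¹) *
       (1 - Pprob n))

/-- `r_2 = ⌊C(n,(n-1)/2) 2^{-(n+1)/2}⌋` (for odd `n`). -/
def r2 (n : ℕ) : ℕ := n.choose ((n - 1) / 2) / 2 ^ ((n + 1) / 2)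

/-- `v_2 = ⌊C(n,(n+3)/2) 2^{-(n+3)/2}⌋` (for odd `n`). -/
def v2 (n : ℕ) : ℕ := n.choose ((n + 3) / 2) / 2 ^ ((n + 3) / 2)

/-- `z_2 = ⌊(C(n,(n+1)/2) + r_2 (n-1)/2 - v_2 (n+3)/2)/2⌋` (for odd `n`). -/
def z2 (n : ℕ) : ℤ :=
  ⌊((n.choose ((n + 1) / 2) : ℚ) + (r2 n : ℚ) * (((n - 1) / 2 : ℕ) : ℚ) -
      (v2 n : ℚ) * (((n + 3) / 2 : ℕ) : ℚ)) / 2⌋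

open Classical in
/-- The second class of `typical' monotone Boolean functions for odd `n`: minimal ones only
in layers `(n-1)/2, (n+1)/2, (n+3)/2`, value `1` from layer `(n+5)/2` upward, exactly `r_2`
minimal ones in layer `(n-1)/2`, exactly `v_2` maximal zeros in layer `(n+3)/2`, and value
`1` on exactly `z_2` vertices of layer `(n+1)/2`. -/
noncomputable def typicalOdd2 (n : ℕ) : Finset ((Fin n → Bool) → Bool) :=
  Finset.univ.filter fun f =>
    Monotone f ∧
    (∀ x, MinimalOne f x →
      weight x = (n - 1) / 2 ∨ weight x = (n + 1) / 2 ∨ weight x = (n + 3) / 2) ∧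
    (∀ x, (n + 5) / 2 ≤ weight x → f x = true) ∧
    {x : Fin n → Bool | MinimalOne f x ∧ weight x = (n - 1) / 2}.ncard = r2 n ∧
    {x : Fin n → Bool | MaximalZero f x ∧ weight x = (n + 3) / 2}.ncard = v2 n ∧
    ({x : Fin n → Bool | f x = true ∧ weight x = (n + 1) / 2}.ncard : ℤ) = z2 n

/-- The probability `Q(n)` that a vertex of layer `(n+1)/2` carries the value `1`. -/
noncomputable def Qprob (n : ℕ) : ℝ :=
  ((n.choose ((n + 1) / 2) : ℝ))⁻¹ *
    ((1 / 2) * ((n.choose ((n + 1) / 2) : ℝ) +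
      (n.choose ((n - 1) / 2) : ℝ) * ((2 : ℝ) ^ ((n + 1) / 2))⁻¹ * (((n : ℝ) - 1) / 2) -
      (n.choose ((n + 3) / 2) : ℝ) * ((2 : ℝ) ^ ((n + 3) / 2))⁻¹ * (((n : ℝ) + 3) / 2)))

/-- `ŝ_2(n)`, the asymptotic expected average sensitivity for the second odd class. -/
noncomputable def s2hat (n : ℕ) : ℝ :=
  (n : ℝ) * (2 : ℝ) ^ (1 - (n : ℤ)) *
    ((1 / 2) * (n.choose ((n - 1) / 2) : ℝ) * ((2 : ℝ) ^ ((n + 1) / 2))⁻¹ +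
     (1 / 2) * (n.choose ((n - 1) / 2) : ℝ) * (1 - ((2 : ℝ) ^ ((n + 1) / 2))⁻¹) * Qprob n +
     (1 / 2) * (n.choose ((n + 3) / 2) : ℝ) * ((2 : ℝ) ^ ((n + 3) / 2))⁻¹ +
     (1 / 2) * (n.choose ((n + 3) / 2) : ℝ) * (1 - ((2 : ℝ) ^ ((n + 3) / 2))⁻¹) *
       (1 - Qprob n))

/-- The number of Boolean vectors of weight `k` is `n.choose k`. -/
theorem card_weight_eq (n k : ℕ) :
    #{x : Fin n → Bool | weight x = k} = n.choose k := by
  have hcard : #(powersetCard k (univ : Finset (Fin n))) = n.choose k := by simp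
  rw [← hcard]
  refine Finset.card_bij (fun x _ => univ.filter fun i => x i = true) ?_ ?_ ?_
  · intro x hx
    rw [Finset.mem_filter] at hx
    simpa [Finset.mem_powersetCard, weight] using hx.2
  · intro x _ y _ hxy
    funext i
    have := Finset.ext_iff.mp hxy i
    rw [Bool.eq_iff_iff]
    simpa using this
  · intro s hs
    refine ⟨fun i => decide (i ∈ s), ?_, by ext; simp⟩
    rw [Finset.mem_filter]
    simpa [weight, Finset.mem_powersetCard] using hs

/-- Prescribing one coordinate to be `1` and another to be `0` leaves at least
`(n-2).choose k` vectors of weight `k+1`. -/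
theorem choose_le_card_weight_eq {n : ℕ} {a b : Fin n} (hab : a ≠ b) (k : ℕ) :
    (n - 2).choose k ≤
      #{x : Fin n → Bool | weight x = k + 1 ∧ x a = true ∧ x b = false} := by
  have hcard : #(univ \ {a, b} : Finset (Fin n)) = n - 2 := by
    rw [Finset.card_sdiff_of_subset (subset_univ _), Finset.card_pair hab]; simp
  rw [← hcard, ← Finset.card_powersetCard]
  refine Finset.card_le_card_of_injOn (fun s i => decide (i ∈ insert a s)) ?_ ?_
  · intro s hs
    simp only [Finset.mem_coe, Finset.mem_powersetCard] at hs
    have ha : a ∉ s := fun h => by simpa using hs.1 h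
    have hb : b ∉ s := fun h => by simpa using hs.1 h
    have hw : (univ.filter fun i => i = a ∨ i ∈ s) = insert a s := by ext; simp
    rw [Finset.mem_coe, Finset.mem_filter]
    simp [weight, hw, Finset.card_insert_of_notMem ha, hs.2, hb, hab.symm]
  · intro s hs t ht hst
    simp only [Finset.mem_coe, Finset.mem_powersetCard] at hs ht
    have has : a ∉ s := fun h => by simpa using hs.1 h
    have hat : a ∉ t := fun h => by simpa using ht.1 h
    have hins : insert a s = insert a t := by
      ext i
      simpa only [decide_eq_decide] using congrFun hst i
    rw [← Finset.erase_insert has, hins, Finset.erase_insert hat]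

theorem weight_le_weight {n : ℕ} {x y : Fin n → Bool} (h : x ≤ y) : weight x ≤ weight y := by
  refine Finset.card_le_card fun i => ?_
  simp only [mem_filter, mem_univ, true_and]
  exact h i

theorem weight_lt_weight {n : ℕ} {x y : Fin n → Bool} (h : x < y) : weight x < weight y := by
  obtain ⟨hle, i, hi⟩ := Pi.lt_def.mp h
  refine Finset.card_lt_card ⟨fun j => ?_, fun hs => ?_⟩
  · simp only [mem_filter, mem_univ, true_and]
    exact hle j
  · have h1 := Bool.lt_iff.mp hi
    have : i ∈ univ.filter fun i => x i = true := hs (by simp [h1.2])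
    simp [h1.1] at this

theorem eq_of_le_of_weight_le {n : ℕ} {x y : Fin n → Bool} (h : x ≤ y)
    (hw : weight y ≤ weight x) : x = y :=
  h.eq_or_lt.resolve_right fun hlt => (weight_lt_weight hlt).not_ge hw

theorem weight_setCoord_false {n : ℕ} {x : Fin n → Bool} {i : Fin n} (h : x i = true) :
    weight (setCoord x i false) + 1 = weight x := by
  have : (univ.filter fun j => setCoord x i false j = true) =
      (univ.filter fun j => x j = true).erase i := by
    ext j
    by_cases hj : j = i <;> simp [setCoord, Function.update_apply, hj]
  rw [weight, this, Finset.card_erase_add_one (by simpa using h), weight]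

theorem setCoord_false_lt {n : ℕ} {x : Fin n → Bool} {i : Fin n} (h : x i = true) :
    setCoord x i false < x := by
  rw [setCoord, update_lt_self_iff, h]
  decide

/-- A vector covered by `y` arises from `y` by erasing a one. -/
theorem exists_eq_setCoord_false {n : ℕ} {x y : Fin n → Bool} (h : x ≤ y)
    (hw : weight y = weight x + 1) : ∃ i, x = setCoord y i false := by
  have hlt : x < y := lt_of_le_of_ne h fun e => by subst e; omega
  obtain ⟨-, i, hi⟩ := Pi.lt_def.mp hlt
  have h1 := Bool.lt_iff.mp hi
  refine ⟨i, eq_of_le_of_weight_le (fun j => ?_) ?_⟩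
  · by_cases hj : j = i
    · subst hj; simp [h1.1]
    · simpa [setCoord, Function.update_of_ne hj] using h j
  · have := weight_setCoord_false h1.2
    omega

/-- A vector covering `x` arises from `x` by adding a one. -/
theorem exists_eq_setCoord_true {n : ℕ} {x y : Fin n → Bool} (h : x ≤ y)
    (hw : weight y = weight x + 1) : ∃ i, y = setCoord x i true := by
  obtain ⟨i, rfl⟩ := exists_eq_setCoord_false h hw
  refine ⟨i, ?_⟩
  have : y i = true := by
    by_contra hi
    have : setCoord y i false = y := by
      rw [setCoord, Function.update_eq_self_iff]; simpa using hi
    rw [this] at hw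
    omega
  rw [setCoord, setCoord, Function.update_idem, ← this, Function.update_eq_self]

/-- `f` is a monotone function whose minimal ones lie in the layers `k`, `k+1`, `k+2`, with value
`1` from layer `k+3` upward, `r` minimal ones in layer `k`, `v` maximal zeros in layer `k+2`, and
value `1` on `z` vertices of layer `k+1`. -/
def IsTypical {n : ℕ} (k r v : ℕ) (z : ℤ) (f : (Fin n → Bool) → Bool) : Prop :=
  Monotone f ∧
  (∀ x, MinimalOne f x → weight x = k ∨ weight x = k + 1 ∨ weight x = k + 2) ∧
  (∀ x, k + 3 ≤ weight x → f x = true) ∧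
  {x : Fin n → Bool | MinimalOne f x ∧ weight x = k}.ncard = r ∧
  {x : Fin n → Bool | MaximalZero f x ∧ weight x = k + 2}.ncard = v ∧
  ({x : Fin n → Bool | f x = true ∧ weight x = k + 1}.ncard : ℤ) = z

theorem mem_typicalOdd1_iff {q : ℕ} {f : (Fin (2 * q + 3) → Bool) → Bool} :
    f ∈ typicalOdd1 (2 * q + 3) ↔
      IsTypical q (r1 (2 * q + 3)) (v1 (2 * q + 3)) (z1 (2 * q + 3)) f := by
  have h0 : (2 * q + 3 - 3) / 2 = q := by omega
  have h1 : (2 * q + 3 - 1) / 2 = q + 1 := by omega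
  have h2 : (2 * q + 3 + 1) / 2 = q + 2 := by omega
  have h3 : (2 * q + 3 + 3) / 2 = q + 3 := by omega
  simp only [typicalOdd1, mem_filter, mem_univ, true_and, h0, h1, h2, h3, IsTypical]

theorem mem_typicalOdd2_iff {q : ℕ} {f : (Fin (2 * q + 3) → Bool) → Bool} :
    f ∈ typicalOdd2 (2 * q + 3) ↔
      IsTypical (q + 1) (r2 (2 * q + 3)) (v2 (2 * q + 3)) (z2 (2 * q + 3)) f := by
  have h1 : (2 * q + 3 - 1) / 2 = q + 1 := by omega
  have h2 : (2 * q + 3 + 1) / 2 = q + 2 := by omega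
  have h3 : (2 * q + 3 + 3) / 2 = q + 3 := by omega
  have h4 : (2 * q + 3 + 5) / 2 = q + 4 := by omega
  simp only [typicalOdd2, mem_filter, mem_univ, true_and, h1, h2, h3, h4, IsTypical, add_assoc,
    Nat.reduceAdd]

/-- Every one of `f` lies above a minimal one. -/
theorem exists_minimalOne_le {n : ℕ} {f : (Fin n → Bool) → Bool} {x : Fin n → Bool}
    (hx : f x = true) : ∃ y ≤ x, MinimalOne f y := by
  obtain ⟨y, hyx, hy⟩ := exists_minimal_le_of_wellFoundedLT (fun y => f y = true) x hx
  refine ⟨y, hyx, hy.prop, fun w hw => ?_⟩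
  by_contra h
  exact hy.not_prop_of_lt hw (by simpa using h)

theorem IsTypical.eq_false_of_weight_lt {n k r v : ℕ} {z : ℤ} {f : (Fin n → Bool) → Bool}
    (hf : IsTypical k r v z f) {x : Fin n → Bool} (hx : weight x < k) : f x = false := by
  by_contra h
  obtain ⟨y, hyx, hy⟩ := exists_minimalOne_le (by simpa using h : f x = true)
  have h1 := weight_le_weight hyx
  have h2 := hf.2.1 y hy
  omega

/-- For monotone `f` the total sensitivity is a weighted count of the ones of `f`. -/
theorem sum_sensAt_of_monotone {n : ℕ} {f : (Fin n → Bool) → Bool} (hf : Monotone f) :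
    ∑ x, (sensAt f x : ℤ) = 2 * ∑ x, (f x).toNat * (2 * (weight x : ℤ) - n) := by
  have hsign (x : Fin n → Bool) :
      ∑ i, (if x i then (1 : ℤ) else -1) = 2 * (weight x : ℤ) - n := by
    have h (i : Fin n) : (if x i then (1 : ℤ) else -1) = 2 * (if x i then 1 else 0) - 1 := by
      split_ifs <;> norm_num
    simp only [h, Finset.sum_sub_distrib, ← Finset.mul_sum, Finset.sum_boole, weight]
    simp
  have hsens (x : Fin n → Bool) : (sensAt f x : ℤ) =
      ∑ i, (if x i then (1 : ℤ) else -1) * ((f x).toNat - (f (flipCoord x i)).toNat) := by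
    rw [sensAt, ← Finset.sum_boole]
    refine Finset.sum_congr rfl fun i _ => ?_
    cases hx : x i
    · have h : f x ≤ f (flipCoord x i) := hf (by simp [flipCoord, hx])
      revert h
      cases f x <;> cases f (flipCoord x i) <;> decide
    · have h : f (flipCoord x i) ≤ f x := hf (by simp [flipCoord, hx])
      revert h
      cases f x <;> cases f (flipCoord x i) <;> decide
  have hflip (i : Fin n) :
      ∑ x : Fin n → Bool, (if x i then (1 : ℤ) else -1) * (f (flipCoord x i)).toNat =
        - ∑ x : Fin n → Bool, (if x i then (1 : ℤ) else -1) * (f x).toNat := by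
    have hinv : Function.Involutive fun x : Fin n → Bool => flipCoord x i := fun x => by
      simp [flipCoord]
    rw [← Finset.sum_neg_distrib]
    refine Fintype.sum_equiv hinv.toPerm _ _ fun x => ?_
    cases hx : x i <;> simp [flipCoord, hx]
  have hweight : ∑ x : Fin n → Bool, ∑ i, (if x i then (1 : ℤ) else -1) * (f x).toNat =
      ∑ x, (f x).toNat * (2 * (weight x : ℤ) - n) := by
    refine Finset.sum_congr rfl fun x _ => ?_
    rw [← Finset.sum_mul, hsign, mul_comm]
  have hflips : ∑ x : Fin n → Bool, ∑ i, (if x i then (1 : ℤ) else -1) *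
      (f (flipCoord x i)).toNat = -∑ x, (f x).toNat * (2 * (weight x : ℤ) - n) := by
    rw [Finset.sum_comm, Finset.sum_congr rfl fun i _ => hflip i, Finset.sum_neg_distrib,
      Finset.sum_comm, hweight]
  rw [Finset.sum_congr rfl fun x _ => hsens x]
  simp only [mul_sub, Finset.sum_sub_distrib] at hweight hflips ⊢
  rw [hweight, hflips]
  ring

theorem sum_weight_ge (n k : ℕ) :
    ∑ x : Fin n → Bool, (if k ≤ weight x then (2 * (weight x : ℤ) - n) else 0) =
      k * n.choose k := by
  have hle (x : Fin n → Bool) : weight x ≤ n := by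
    simpa [weight] using Finset.card_le_univ (univ.filter fun i => x i = true)
  induction h : n + 1 - k generalizing k with
  | zero =>
    rw [Nat.choose_eq_zero_of_lt (by omega)]
    refine (Finset.sum_eq_zero fun x _ => ?_).trans (by simp)
    have := hle x
    rw [if_neg (by omega)]
  | succ d ih =>
    have hsplit (x : Fin n → Bool) : (if k ≤ weight x then (2 * (weight x : ℤ) - n) else 0) =
        (if k + 1 ≤ weight x then (2 * (weight x : ℤ) - n) else 0) +
          if weight x = k then (2 * (k : ℤ) - n) else 0 := by
      rcases lt_trichotomy (weight x) k with h | h | h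
      · rw [if_neg (by omega), if_neg (by omega), if_neg (by omega), add_zero]
      · rw [if_pos (by omega), if_neg (by omega), if_pos h, h, zero_add]
      · rw [if_pos (by omega), if_pos (by omega), if_neg (by omega), add_zero]
    rw [Finset.sum_congr rfl fun x _ => hsplit x, Finset.sum_add_distrib,
      ih (k + 1) (by omega), ← Finset.sum_filter, Finset.sum_const, card_weight_eq]
    have hc := Nat.choose_succ_right_eq n k
    zify [show k ≤ n by omega] at hc
    push_cast
    rw [nsmul_eq_mul]
    linarith

/-- A monotone function in `2 q + 3` variables that is constant outside the four middle layers has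
almost the average sensitivity of the majority function. -/
theorem abs_avgSens_sub_le {q : ℕ} {f : (Fin (2 * q + 3) → Bool) → Bool} (hf : Monotone f)
    (h0 : ∀ x, weight x < q → f x = false) (h1 : ∀ x, q + 4 ≤ weight x → f x = true) :
    |avgSens f - 2 * (2 ^ (2 * q + 3) : ℝ)⁻¹ * ((q + 2) * (2 * q + 3).choose (q + 1))| ≤
      2 * (2 ^ (2 * q + 3) : ℝ)⁻¹ * (12 * (2 * q + 3).choose (q + 1)) := by
  set C := (2 * q + 3).choose (q + 1) with hC
  have hmid : (2 * q + 3).choose (q + 2) = C := Nat.choose_symm_of_eq_add (by omega)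
  have hlayer (k : ℕ) : (2 * q + 3).choose k ≤ C := by
    have := Nat.choose_le_middle k (2 * q + 3)
    rwa [show (2 * q + 3) / 2 = q + 1 by omega] at this
  have hmaj := sum_weight_ge (2 * q + 3) (q + 2)
  rw [hmid] at hmaj
  have hbound : |∑ x, (f x).toNat * (2 * (weight x : ℤ) - (2 * q + 3 : ℕ)) - ((q + 2 : ℕ) * C : ℤ)|
      ≤ 12 * C := by
    rw [← hmaj, ← Finset.sum_sub_distrib]
    refine (Finset.abs_sum_le_sum_abs _ _).trans ?_
    calc _ ≤ ∑ x : Fin (2 * q + 3) → Bool, ∑ k ∈ Finset.Ico q (q + 4),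
          (if weight x = k then (3 : ℤ) else 0) := by
          refine Finset.sum_le_sum fun x _ => ?_
          rw [Finset.sum_ite_eq]
          rcases lt_or_ge (weight x) q with hx | hx
          · rw [h0 x hx, if_neg (by omega)]
            split_ifs <;> simp
          · rcases lt_or_ge (weight x) (q + 4) with hx' | hx'
            · rw [if_pos (Finset.mem_Ico.mpr ⟨hx, hx'⟩)]
              rw [abs_le]
              cases f x <;> push_cast <;> grind
            · rw [h1 x hx', if_pos (by omega)]
              split_ifs <;> simp
      _ = ∑ k ∈ Finset.Ico q (q + 4), 3 * ((2 * q + 3).choose k : ℤ) := by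
          rw [Finset.sum_comm]
          refine Finset.sum_congr rfl fun k _ => ?_
          rw [← Finset.sum_filter, Finset.sum_const, card_weight_eq, nsmul_eq_mul, mul_comm]
      _ ≤ ∑ k ∈ Finset.Ico q (q + 4), 3 * (C : ℤ) :=
          Finset.sum_le_sum fun k _ => by gcongr; exact hlayer k
      _ = 12 * C := by simp; ring
  have hsum := sum_sensAt_of_monotone hf
  have hbound' : |(∑ x, (sensAt f x : ℝ)) - 2 * ((q + 2) * C)| ≤ 2 * (12 * C) := by
    have : |(∑ x, (sensAt f x : ℤ)) - 2 * ((q + 2) * C)| ≤ 2 * (12 * C) := by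
      rw [hsum, ← mul_sub, abs_mul, abs_two]
      push_cast at hbound ⊢
      gcongr
    exact_mod_cast this
  have hfactor (c S : ℝ) :
      c * S - 2 * c * ((q + 2) * C) = c * (S - 2 * ((q + 2) * C)) := by ring
  rw [avgSens, hfactor, abs_mul, abs_of_pos (by positivity)]
  refine (mul_le_mul_of_nonneg_left hbound' (by positivity)).trans_eq ?_
  ring

/-- Minimal ones containing `a` and maximal zeros avoiding `a` and containing `b` never conflict,
so any sufficiently small prescribed layer counts are realised by a function. -/
theorem exists_isTypical {n k r v z : ℕ} {a b : Fin n} (hab : a ≠ b) (hk : 1 ≤ k)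
    (hr : r ≤ (n - 2).choose (k - 1)) (hv : v ≤ (n - 2).choose (k + 1))
    (hrz : r * n ≤ z) (hzv : z + v * n ≤ n.choose (k + 1)) :
    ∃ f : (Fin n → Bool) → Bool, IsTypical k r v z f := by
  obtain ⟨A, hA, rfl⟩ := Finset.exists_subset_card_eq
    (hr.trans (choose_le_card_weight_eq hab (k - 1)))
  obtain ⟨B, hB, rfl⟩ := Finset.exists_subset_card_eq
    (hv.trans (choose_le_card_weight_eq hab.symm (k + 1)))
  replace hA {x} (hx : x ∈ A) : weight x = k ∧ x a = true := by
    have := (Finset.mem_filter.mp (hA hx)).2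
    exact ⟨by omega, this.2.1⟩
  replace hB {x} (hx : x ∈ B) : weight x = k + 2 ∧ x b = true ∧ x a = false :=
    (Finset.mem_filter.mp (hB hx)).2
  let up := (A.biUnion fun x => univ.image fun i => setCoord x i true).filter
    fun x => weight x = k + 1
  let down := B.biUnion fun x => univ.image fun i => setCoord x i false
  let layer : Finset (Fin n → Bool) := univ.filter fun x => weight x = k + 1
  have hup : #up ≤ #A * n := (Finset.card_filter_le _ _).trans
    (Finset.card_biUnion_le_card_mul _ _ _ fun x _ => Finset.card_image_le.trans (by simp))
  have hdown : #down ≤ #B * n :=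
    Finset.card_biUnion_le_card_mul _ _ _ fun x _ => Finset.card_image_le.trans (by simp)
  have hlayer : #layer = n.choose (k + 1) := card_weight_eq n (k + 1)
  have hsub : up ⊆ layer \ down := by
    intro y hy
    simp only [up, Finset.mem_filter, Finset.mem_biUnion, Finset.mem_image, Finset.mem_univ,
      true_and] at hy
    obtain ⟨⟨x, hx, i, rfl⟩, hw⟩ := hy
    refine Finset.mem_sdiff.mpr ⟨Finset.mem_filter.mpr ⟨mem_univ _, hw⟩, fun hd => ?_⟩
    simp only [down, Finset.mem_biUnion, Finset.mem_image, Finset.mem_univ, true_and] at hd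
    obtain ⟨w, hw, l, hl⟩ := hd
    have h1 : setCoord x i true a = true := by
      simp [setCoord, Function.update_apply, (hA hx).2]
    have h2 : setCoord w l false a = false := by
      simp [setCoord, Function.update_apply, (hB hw).2.2]
    rw [hl, h1] at h2
    exact absurd h2 (by decide)
  obtain ⟨Z, hZup, hZdown, rfl⟩ := Finset.exists_subsuperset_card_eq hsub (hup.trans hrz)
    (by have := Finset.le_card_sdiff down layer; omega)
  have hZ {x} (hx : x ∈ Z) : weight x = k + 1 :=
    (Finset.mem_filter.mp (Finset.mem_sdiff.mp (hZdown hx)).1).2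
  let f : (Fin n → Bool) → Bool := fun x =>
    decide (x ∈ A ∨ x ∈ Z ∨ (weight x = k + 2 ∧ x ∉ B) ∨ k + 3 ≤ weight x)
  have hf x : f x = true ↔ x ∈ A ∨ x ∈ Z ∨ (weight x = k + 2 ∧ x ∉ B) ∨ k + 3 ≤ weight x :=
    decide_eq_true_iff
  have hf' x : f x = false ↔ ¬ f x = true := by simp
  have hweight {x} (hx : f x = true) : k ≤ weight x := by
    rcases (hf x).mp hx with h | h | h | h
    · exact (hA h).1.ge
    · have := hZ h; omega
    · omega
    · omega
  refine ⟨f, ?_, ?_, fun x hx => (hf x).mpr (by tauto), ?_, ?_, ?_⟩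
  · intro x y hxy hx
    rcases hxy.eq_or_lt with rfl | hlt
    · exact hx
    have hw := weight_lt_weight hlt
    rw [hf] at hx ⊢
    by_cases hy3 : k + 3 ≤ weight y
    · tauto
    rcases hx with hx | hx | hx | hx
    · have hAx := hA hx
      by_cases hy1 : weight y = k + 1
      · obtain ⟨i, rfl⟩ := exists_eq_setCoord_true hxy (by omega)
        refine Or.inr (Or.inl (hZup (Finset.mem_filter.mpr ⟨?_, hy1⟩)))
        exact Finset.mem_biUnion.mpr ⟨x, hx, Finset.mem_image_of_mem _ (mem_univ i)⟩
      · refine Or.inr (Or.inr (Or.inl ⟨by omega, fun hy => ?_⟩))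
        have h1 : y a = true := hxy a hAx.2
        rw [(hB hy).2.2] at h1
        exact absurd h1 (by decide)
    · have hZx := hZ hx
      refine Or.inr (Or.inr (Or.inl ⟨by omega, fun hy => ?_⟩))
      obtain ⟨i, rfl⟩ := exists_eq_setCoord_false hxy (by omega)
      exact (Finset.mem_sdiff.mp (hZdown hx)).2
        (Finset.mem_biUnion.mpr ⟨y, hy, Finset.mem_image_of_mem _ (mem_univ i)⟩)
    · omega
    · omega
  · intro x hx
    have hk := hweight hx.1
    by_contra hne
    have hw : k + 3 ≤ weight x := by omega
    obtain ⟨i, hi, hib⟩ : ∃ i, x i = true ∧ setCoord x i false b = false := by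
      cases hb : x b
      · obtain ⟨i, hi⟩ := Finset.card_pos.mp (show 0 < weight x by omega)
        exact ⟨i, (Finset.mem_filter.mp hi).2, by simp [setCoord, Function.update_apply, hb]⟩
      · exact ⟨b, hb, by simp [setCoord]⟩
    have hlt := hx.2 _ (setCoord_false_lt hi)
    have hwt := weight_setCoord_false hi
    rw [hf', hf] at hlt
    refine hlt ?_
    by_cases hw2 : weight (setCoord x i false) = k + 2
    · refine Or.inr (Or.inr (Or.inl ⟨hw2, fun hmem => ?_⟩))
      have := (hB hmem).2.1
      rw [hib] at this
      exact absurd this (by decide)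
    · exact Or.inr (Or.inr (Or.inr (by omega)))
  · rw [← Set.ncard_coe_finset A]
    congr 1
    ext x
    refine ⟨fun ⟨hx, hw⟩ => ?_, fun hx => ⟨⟨(hf x).mpr (Or.inl hx), fun y hy => ?_⟩, (hA hx).1⟩⟩
    · rcases (hf x).mp hx.1 with h | h | h | h
      · exact h
      · have := hZ h; omega
      · omega
      · omega
    · rw [hf']
      intro h
      have h1 := hweight h
      have h2 := weight_lt_weight hy
      have h3 := hA hx
      omega
  · rw [← Set.ncard_coe_finset B]
    congr 1
    ext x
    refine ⟨fun ⟨hx, hw⟩ => ?_, fun hx => ⟨⟨?_, fun y hy => ?_⟩, (hB hx).1⟩⟩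
    · have h := hx.1
      rw [hf', hf] at h
      by_contra hxB
      exact h (Or.inr (Or.inr (Or.inl ⟨hw, hxB⟩)))
    · rw [hf', hf]
      have hBx := (hB hx).1
      rintro (h | h | h | h)
      · have := (hA h).1; omega
      · have := hZ h; omega
      · exact h.2 hx
      · omega
    · have h1 := weight_lt_weight hy
      have h2 := (hB hx).1
      exact (hf y).mpr (Or.inr (Or.inr (Or.inr (by omega))))
  · rw [← Set.ncard_coe_finset Z]
    congr 2
    ext x
    refine ⟨fun ⟨hx, hw⟩ => ?_, fun hx => ⟨(hf x).mpr (Or.inr (Or.inl hx)), hZ hx⟩⟩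
    rcases (hf x).mp hx with h | h | h | h
    · have := (hA h).1; omega
    · exact h
    · omega
    · omega

theorem choose_mul_mul_sub (n k : ℕ) :
    (n + 2).choose (k + 1) * ((k + 1) * (n + 1 - k)) = (n + 2) * (n + 1) * n.choose k := by
  rcases le_or_gt k n with h | h
  · have h1 := Nat.add_one_mul_choose_eq (n + 1) k
    have h2 := Nat.choose_mul_succ_eq n k
    calc _ = (n + 2).choose (k + 1) * (k + 1) * (n + 1 - k) := by ring
      _ = (n + 2) * ((n + 1).choose k * (n + 1 - k)) := by rw [← h1]; ring
      _ = _ := by rw [← h2]; ring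
  · rw [Nat.choose_eq_zero_of_lt h, show n + 1 - k = 0 by omega]
    simp

theorem choose_div_two_pow_le {n k p : ℕ} (hp : 3 ≤ p)
    (h : (n + 2) * (n + 1) ≤ 8 * ((k + 1) * (n + 1 - k))) :
    (n + 2).choose (k + 1) / 2 ^ p ≤ n.choose k := by
  have h8 : (n + 2).choose (k + 1) ≤ 8 * n.choose k := by
    have hpos : 0 < (k + 1) * (n + 1 - k) := by
      have : 0 < (n + 2) * (n + 1) := by positivity
      omega
    refine Nat.le_of_mul_le_mul_right ?_ hpos
    rw [choose_mul_mul_sub]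
    calc _ ≤ 8 * ((k + 1) * (n + 1 - k)) * n.choose k := by gcongr
      _ = _ := by ring
  refine Nat.div_le_of_le_mul (h8.trans ?_)
  gcongr
  calc 8 = 2 ^ 3 := by norm_num
    _ ≤ 2 ^ p := Nat.pow_le_pow_right (by norm_num) hp

theorem div_two_pow_mul_le {c C n p : ℕ} (hc : c ≤ C) (hp : 8 * n ≤ 2 ^ p) :
    8 * (c / 2 ^ p * n) ≤ C :=
  calc 8 * (c / 2 ^ p * n) = c / 2 ^ p * (8 * n) := by ring
    _ ≤ c / 2 ^ p * 2 ^ p := by gcongr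
    _ ≤ c := Nat.div_mul_le_self _ _
    _ ≤ C := hc

theorem exists_nat_floor_half {C r v a b n : ℕ} (hC : 8 ≤ C) (ha : a ≤ n) (hb : b ≤ n)
    (hr : 8 * (r * n) ≤ C) (hv : 8 * (v * n) ≤ C) :
    ∃ z : ℕ, (z : ℤ) = ⌊((C : ℚ) + r * a - v * b) / 2⌋ ∧ r * n ≤ z ∧ z + v * n ≤ C := by
  have hra : r * a ≤ r * n := by gcongr
  have hvb : v * b ≤ v * n := by gcongr
  have hra0 : 0 ≤ r * a := Nat.zero_le _
  have hvb0 : 0 ≤ v * b := Nat.zero_le _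
  have hfloor : ⌊((C : ℚ) + r * a - v * b) / 2⌋ = (C + r * a - v * b : ℤ) / 2 := by
    have := Rat.floor_intCast_div_natCast (C + r * a - v * b : ℤ) 2
    push_cast at this
    exact this
  refine ⟨((C + r * a - v * b : ℤ) / 2).toNat, ?_, ?_, ?_⟩
  · rw [hfloor]
    zify at *
    omega
  · zify at *
    omega
  · zify at *
    omega

theorem eight_mul_le_two_pow {q : ℕ} (hq : 6 ≤ q) : 8 * (2 * q + 3) ≤ 2 ^ (q + 2) := by
  induction q, hq using Nat.le_induction with
  | base => norm_num
  | succ q hq ih => rw [show q + 1 + 2 = q + 2 + 1 by ring, pow_succ]; omega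

theorem typicalOdd1_nonempty {q : ℕ} (hq : 6 ≤ q) : (typicalOdd1 (2 * q + 3)).Nonempty := by
  have h0 : (2 * q + 3 - 3) / 2 = q := by omega
  have h1 : (2 * q + 3 - 1) / 2 = q + 1 := by omega
  have h2 : (2 * q + 3 + 1) / 2 = q + 2 := by omega
  have h3 : (2 * q + 3 + 3) / 2 = q + 3 := by omega
  have hlayer (k : ℕ) : (2 * q + 3).choose k ≤ (2 * q + 3).choose (q + 1) := by
    have := Nat.choose_le_middle k (2 * q + 3)
    rwa [show (2 * q + 3) / 2 = q + 1 by omega] at this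
  have hpow := eight_mul_le_two_pow hq
  have hbig : 8 ≤ (2 * q + 3).choose (q + 1) :=
    le_trans (by rw [Nat.choose_one_right]; omega) (hlayer 1)
  obtain ⟨z, hz, hrz, hzv⟩ := exists_nat_floor_half (n := 2 * q + 3) (a := q + 3) (b := q + 2)
    (r := r1 (2 * q + 3)) (v := v1 (2 * q + 3)) hbig (by omega) (by omega)
    (by rw [r1, h0, h3]; exact div_two_pow_mul_le (hlayer q) (hpow.trans (by gcongr <;> omega)))
    (by rw [v1, h2]; exact div_two_pow_mul_le (hlayer _) hpow)
  obtain ⟨p, rfl⟩ : ∃ p, q = p + 1 := ⟨q - 1, by omega⟩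
  have hab : (0 : Fin (2 * (p + 1) + 3)) ≠ 1 := by simp
  obtain ⟨f, hf⟩ := exists_isTypical hab (by omega : 1 ≤ p + 1)
    (r := r1 (2 * (p + 1) + 3)) (v := v1 (2 * (p + 1) + 3))
    (by rw [r1, h0, h3]
        exact choose_div_two_pow_le (by omega) (by
          rw [show 2 * (p + 1) + 1 + 1 - p = p + 4 by omega]; nlinarith))
    (by rw [v1, h2]
        exact choose_div_two_pow_le (by omega) (by
          rw [show 2 * (p + 1) + 1 + 1 - (p + 2) = p + 2 by omega]; nlinarith)) hrz hzv
  refine ⟨f, mem_typicalOdd1_iff.mpr ?_⟩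
  rwa [z1, h1, h2, h3, ← hz]

theorem typicalOdd2_nonempty {q : ℕ} (hq : 6 ≤ q) : (typicalOdd2 (2 * q + 3)).Nonempty := by
  have h1 : (2 * q + 3 - 1) / 2 = q + 1 := by omega
  have h2 : (2 * q + 3 + 1) / 2 = q + 2 := by omega
  have h3 : (2 * q + 3 + 3) / 2 = q + 3 := by omega
  have hmid : (2 * q + 3).choose (q + 2) = (2 * q + 3).choose (q + 1) :=
    Nat.choose_symm_of_eq_add (by omega)
  have hlayer (k : ℕ) : (2 * q + 3).choose k ≤ (2 * q + 3).choose (q + 2) := by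
    have := Nat.choose_le_middle k (2 * q + 3)
    rwa [show (2 * q + 3) / 2 = q + 1 by omega, ← hmid] at this
  have hpow := eight_mul_le_two_pow hq
  have hbig : 8 ≤ (2 * q + 3).choose (q + 2) :=
    le_trans (by rw [Nat.choose_one_right]; omega) (hlayer 1)
  obtain ⟨z, hz, hrz, hzv⟩ := exists_nat_floor_half (n := 2 * q + 3) (a := q + 1) (b := q + 3)
    (r := r2 (2 * q + 3)) (v := v2 (2 * q + 3)) hbig (by omega) (by omega)
    (by rw [r2, h1, h2]; exact div_two_pow_mul_le (hlayer _) hpow)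
    (by rw [v2, h3]; exact div_two_pow_mul_le (hlayer _) (hpow.trans (by gcongr <;> omega)))
  have hab : (0 : Fin (2 * q + 3)) ≠ 1 := by simp
  obtain ⟨f, hf⟩ := exists_isTypical hab (by omega : 1 ≤ q + 1)
    (r := r2 (2 * q + 3)) (v := v2 (2 * q + 3))
    (by rw [r2, h1, h2]
        exact choose_div_two_pow_le (by omega) (by
          rw [show 2 * q + 1 + 1 - q = q + 2 by omega]; nlinarith))
    (by rw [v2, h3]
        exact choose_div_two_pow_le (by omega) (by
          rw [show 2 * q + 1 + 1 - (q + 1 + 1) = q by omega]; nlinarith)) hrz hzv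
  refine ⟨f, mem_typicalOdd2_iff.mpr ?_⟩
  rwa [z2, h1, h2, h3, ← hz]

theorem abs_expAvgSens_sub_le {n : ℕ} {T : Finset ((Fin n → Bool) → Bool)} (hT : T.Nonempty)
    {c ε : ℝ} (h : ∀ f ∈ T, |avgSens f - c| ≤ ε) : |expAvgSens T - c| ≤ ε := by
  have hpos : (0 : ℝ) < #T := by exact_mod_cast hT.card_pos
  have hsub : expAvgSens T - c = (∑ f ∈ T, (avgSens f - c)) / #T := by
    rw [expAvgSens, Finset.sum_sub_distrib, Finset.sum_const, nsmul_eq_mul]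
    field_simp
  rw [hsub, abs_div, abs_of_pos hpos, div_le_iff₀ hpos, mul_comm, ← nsmul_eq_mul]
  exact (Finset.abs_sum_le_sum_abs _ _).trans (Finset.sum_le_card_nsmul _ _ _ h)

/-- The average sensitivity of the majority function of `2 q + 3` variables. -/
noncomputable def majoritySens (q : ℕ) : ℝ :=
  2 * (2 ^ (2 * q + 3) : ℝ)⁻¹ * ((q + 2) * (2 * q + 3).choose (q + 1))

theorem majoritySens_pos (q : ℕ) : 0 < majoritySens q := by
  have : 0 < (2 * q + 3).choose (q + 1) := Nat.choose_pos (by omega)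
  unfold majoritySens
  positivity

theorem tendsto_expAvgSens_div (T : ∀ q, Finset ((Fin (2 * q + 3) → Bool) → Bool))
    (hT : ∀ᶠ q in Filter.atTop, (T q).Nonempty)
    (hmono : ∀ q, ∀ f ∈ T q, Monotone f)
    (h0 : ∀ q, ∀ f ∈ T q, ∀ x, weight x < q → f x = false)
    (h1 : ∀ q, ∀ f ∈ T q, ∀ x, q + 4 ≤ weight x → f x = true) :
    Filter.Tendsto (fun q => expAvgSens (T q) / majoritySens q) Filter.atTop (nhds 1) := by
  have hlim : Filter.Tendsto (fun q : ℕ => 12 / ((q : ℝ) + 2)) Filter.atTop (nhds 0) :=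
    Filter.Tendsto.div_atTop tendsto_const_nhds
      (Filter.tendsto_atTop_add_const_right _ _ tendsto_natCast_atTop_atTop)
  refine tendsto_iff_dist_tendsto_zero.mpr
    (squeeze_zero' (Filter.Eventually.of_forall fun _ => dist_nonneg) ?_ hlim)
  filter_upwards [hT] with q hq
  have hpos := majoritySens_pos q
  have hb := abs_expAvgSens_sub_le hq fun f hf =>
    abs_avgSens_sub_le (hmono q f hf) (h0 q f hf) (h1 q f hf)
  rw [Real.dist_eq, div_sub_one hpos.ne', abs_div, abs_of_pos hpos, div_le_iff₀ hpos]
  refine hb.trans_eq ?_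
  rw [majoritySens]
  field_simp

theorem choose_eq_middle_mul (q : ℕ) : ((2 * q + 3).choose q : ℝ) =
    (2 * q + 3).choose (q + 1) * ((q + 1) / (q + 3)) := by
  have h := Nat.choose_succ_right_eq (2 * q + 3) q
  rw [show 2 * q + 3 - q = q + 3 by omega] at h
  have h' : ((2 * q + 3).choose (q + 1) : ℝ) * (q + 1) = (2 * q + 3).choose q * (q + 3) := by
    exact_mod_cast h
  field_simp
  linarith

/-- The common form of `ŝ_1 / majoritySens` and `ŝ_2 / majoritySens`: `d` and `e` are the sizes of
the outer layers relative to the middle ones, `x` and `y` the exceptional fractions. -/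
theorem tendsto_bracket {a d e x y p : ℕ → ℝ}
    (ha : Filter.Tendsto a Filter.atTop (nhds 2))
    (hd : Filter.Tendsto d Filter.atTop (nhds 1)) (he : Filter.Tendsto e Filter.atTop (nhds 1))
    (hx : Filter.Tendsto x Filter.atTop (nhds 0)) (hy : Filter.Tendsto y Filter.atTop (nhds 0))
    (hp : Filter.Tendsto p Filter.atTop (nhds (1 / 2))) :
    Filter.Tendsto (fun q => a q * (1 / 2 * d q * x q + 1 / 2 * d q * (1 - x q) * p q +
      1 / 2 * e q * y q + 1 / 2 * e q * (1 - y q) * (1 - p q))) Filter.atTop (nhds 1) := by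
  have h := ha.mul (((((hd.const_mul (1 / 2)).mul hx).add
    (((hd.const_mul (1 / 2)).mul (hx.const_sub 1)).mul hp)).add
    ((he.const_mul (1 / 2)).mul hy)).add
    (((he.const_mul (1 / 2)).mul (hy.const_sub 1)).mul (hp.const_sub 1)))
  convert h using 2
  norm_num

theorem tendsto_two_pow_inv (j : ℕ) :
    Filter.Tendsto (fun q : ℕ => ((2 : ℝ) ^ (q + j))⁻¹) Filter.atTop (nhds 0) :=
  ((tendsto_pow_atTop_atTop_of_one_lt one_lt_two).comp
    (Filter.tendsto_add_atTop_nat j)).inv_tendsto_atTop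

theorem tendsto_two_pow_inv_mul (i j : ℕ) :
    Filter.Tendsto (fun q : ℕ => ((2 : ℝ) ^ (q + j))⁻¹ * ((q : ℝ) + i)) Filter.atTop (nhds 0) := by
  have h1 : Filter.Tendsto (fun q : ℕ => (q : ℝ) / 2 ^ q) Filter.atTop (nhds 0) := by
    simpa using tendsto_pow_const_div_const_pow_of_one_lt 1 (one_lt_two : (1 : ℝ) < 2)
  have h := (h1.mul_const ((2 : ℝ) ^ j)⁻¹).add ((tendsto_two_pow_inv j).mul_const (i : ℝ))
  simp only [zero_mul, add_zero] at h
  refine h.congr fun q => ?_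
  rw [pow_add]
  field_simp

theorem tendsto_add_div_add (i j : ℕ) :
    Filter.Tendsto (fun q : ℕ => ((q : ℝ) + i) / (q + j)) Filter.atTop (nhds 1) := by
  have h : Filter.Tendsto (fun q : ℕ => 1 + ((i : ℝ) - j) / ((q : ℝ) + j)) Filter.atTop
      (nhds (1 + 0)) :=
    (Filter.Tendsto.div_atTop tendsto_const_nhds
      (Filter.tendsto_atTop_add_const_right _ _ tendsto_natCast_atTop_atTop)).const_add 1
  rw [add_zero] at h
  refine h.congr' ?_
  filter_upwards [Filter.eventually_gt_atTop 0] with q hq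
  have : (q : ℝ) + j ≠ 0 := by positivity
  field_simp
  ring

theorem tendsto_two_mul_add_div :
    Filter.Tendsto (fun q : ℕ => (2 * (q : ℝ) + 3) / (q + 2)) Filter.atTop (nhds 2) := by
  have h := (tendsto_add_div_add 1 2).add (tendsto_add_div_add 2 2)
  norm_num at h
  refine h.congr fun q => ?_
  rw [← add_div]
  ring

theorem two_zpow_one_sub (n : ℕ) : (2 : ℝ) ^ (1 - (n : ℤ)) = 2 * (2 ^ n)⁻¹ := by
  rw [zpow_sub₀ two_ne_zero, zpow_one, zpow_natCast, div_eq_mul_inv]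

theorem tendsto_s1hat_div :
    Filter.Tendsto (fun q => s1hat (2 * q + 3) / majoritySens q) Filter.atTop (nhds 1) := by
  have hd : Filter.Tendsto (fun q : ℕ => ((q : ℝ) + 1) / (q + 3)) Filter.atTop (nhds 1) := by
    simpa using tendsto_add_div_add 1 3
  have hP : Filter.Tendsto (fun q => Pprob (2 * q + 3)) Filter.atTop (nhds (1 / 2)) := by
    have h := (((hd.mul (tendsto_two_pow_inv_mul 3 3)).const_add 1).sub
      (tendsto_two_pow_inv_mul 2 2)).const_mul (1 / 2)
    norm_num at h
    refine h.congr fun q => ?_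
    have hC : ((2 * q + 3).choose (q + 1) : ℝ) ≠ 0 := by
      exact_mod_cast (Nat.choose_pos (by omega)).ne'
    have hmid : (2 * q + 3).choose (q + 2) = (2 * q + 3).choose (q + 1) :=
      Nat.choose_symm_of_eq_add (by omega)
    rw [Pprob, show (2 * q + 3 - 3) / 2 = q by omega, show (2 * q + 3 - 1) / 2 = q + 1 by omega,
      show (2 * q + 3 + 1) / 2 = q + 2 by omega, show (2 * q + 3 + 3) / 2 = q + 3 by omega,
      hmid, choose_eq_middle_mul]
    push_cast
    field_simp
    ring
  refine (tendsto_bracket tendsto_two_mul_add_div hd tendsto_const_nhds (tendsto_two_pow_inv 3)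
    (tendsto_two_pow_inv 2) hP).congr fun q => ?_
  have hC : ((2 * q + 3).choose (q + 1) : ℝ) ≠ 0 := by
    exact_mod_cast (Nat.choose_pos (by omega)).ne'
  have hmid : (2 * q + 3).choose (q + 2) = (2 * q + 3).choose (q + 1) :=
    Nat.choose_symm_of_eq_add (by omega)
  rw [s1hat, majoritySens, two_zpow_one_sub, show (2 * q + 3 - 3) / 2 = q by omega,
    show (2 * q + 3 + 1) / 2 = q + 2 by omega, show (2 * q + 3 + 3) / 2 = q + 3 by omega,
    hmid, choose_eq_middle_mul]
  generalize Pprob (2 * q + 3) = P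
  push_cast
  field_simp

theorem tendsto_s2hat_div :
    Filter.Tendsto (fun q => s2hat (2 * q + 3) / majoritySens q) Filter.atTop (nhds 1) := by
  have hd : Filter.Tendsto (fun q : ℕ => ((q : ℝ) + 1) / (q + 3)) Filter.atTop (nhds 1) := by
    simpa using tendsto_add_div_add 1 3
  have hQ : Filter.Tendsto (fun q => Qprob (2 * q + 3)) Filter.atTop (nhds (1 / 2)) := by
    have h := (((tendsto_two_pow_inv_mul 1 2).const_add 1).sub
      (hd.mul (tendsto_two_pow_inv_mul 3 3))).const_mul (1 / 2)
    norm_num at h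
    refine h.congr fun q => ?_
    have hC : ((2 * q + 3).choose (q + 1) : ℝ) ≠ 0 := by
      exact_mod_cast (Nat.choose_pos (by omega)).ne'
    have hmid : (2 * q + 3).choose (q + 2) = (2 * q + 3).choose (q + 1) :=
      Nat.choose_symm_of_eq_add (by omega)
    have hout : (2 * q + 3).choose (q + 3) = (2 * q + 3).choose q :=
      Nat.choose_symm_of_eq_add (by omega)
    rw [Qprob, show (2 * q + 3 - 1) / 2 = q + 1 by omega,
      show (2 * q + 3 + 1) / 2 = q + 2 by omega, show (2 * q + 3 + 3) / 2 = q + 3 by omega,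
      hmid, hout, choose_eq_middle_mul]
    push_cast
    field_simp
    ring
  refine (tendsto_bracket tendsto_two_mul_add_div tendsto_const_nhds hd (tendsto_two_pow_inv 2)
    (tendsto_two_pow_inv 3) hQ).congr fun q => ?_
  have hC : ((2 * q + 3).choose (q + 1) : ℝ) ≠ 0 := by
    exact_mod_cast (Nat.choose_pos (by omega)).ne'
  have hout : (2 * q + 3).choose (q + 3) = (2 * q + 3).choose q :=
    Nat.choose_symm_of_eq_add (by omega)
  rw [s2hat, majoritySens, two_zpow_one_sub, show (2 * q + 3 - 1) / 2 = q + 1 by omega,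
    show (2 * q + 3 + 1) / 2 = q + 2 by omega, show (2 * q + 3 + 3) / 2 = q + 3 by omega,
    hout, choose_eq_middle_mul]
  generalize Qprob (2 * q + 3) = Q
  push_cast
  field_simp

theorem tendsto_odd_of_tendsto {α : Type*} {l : Filter α} {g : ℕ → α}
    (h : Filter.Tendsto (fun q => g (2 * q + 3)) Filter.atTop l) :
    Filter.Tendsto g (Filter.atTop ⊓ Filter.principal {n : ℕ | Odd n}) l := by
  have hle : Filter.atTop ⊓ Filter.principal {n : ℕ | Odd n} ≤
      Filter.map (fun q => 2 * q + 3) Filter.atTop := by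
    intro s hs
    obtain ⟨N, hN⟩ := Filter.mem_atTop_sets.mp (Filter.mem_map.mp hs)
    rw [Filter.mem_inf_principal]
    filter_upwards [Filter.eventually_ge_atTop (2 * N + 3)] with n hn hodd
    obtain ⟨m, rfl⟩ := hodd
    have := hN (m - 1) (by omega)
    rwa [Set.mem_preimage, show 2 * (m - 1) + 3 = 2 * m + 1 by omega] at this
  exact (Filter.tendsto_map'_iff.mpr h).mono_left hle

/-- Theorem 5, odd case: if `f` is drawn by choosing one of the two odd
typical classes with probability `1/2` each and then uniformly within it, the expected
average sensitivity satisfies `E[s^f] ∼ (ŝ_1(n) + ŝ_2(n))/2` as `n → ∞` through odd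
values. -/
theorem expected_avgSens_odd :
    Filter.Tendsto
      (fun n : ℕ =>
        ((1 / 2) * expAvgSens (typicalOdd1 n) + (1 / 2) * expAvgSens (typicalOdd2 n)) /
          ((1 / 2) * (s1hat n + s2hat n)))
      (Filter.atTop ⊓ Filter.principal {n : ℕ | Odd n}) (nhds 1) := by
  refine tendsto_odd_of_tendsto ?_
  have hT1 := tendsto_expAvgSens_div (fun q => typicalOdd1 (2 * q + 3))
    (Filter.eventually_atTop.mpr ⟨6, fun q hq => typicalOdd1_nonempty hq⟩)
    (fun q f hf => (mem_typicalOdd1_iff.mp hf).1)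
    (fun q f hf x hx => (mem_typicalOdd1_iff.mp hf).eq_false_of_weight_lt hx)
    (fun q f hf x hx => (mem_typicalOdd1_iff.mp hf).2.2.1 x (by omega))
  have hT2 := tendsto_expAvgSens_div (fun q => typicalOdd2 (2 * q + 3))
    (Filter.eventually_atTop.mpr ⟨6, fun q hq => typicalOdd2_nonempty hq⟩)
    (fun q f hf => (mem_typicalOdd2_iff.mp hf).1)
    (fun q f hf x hx => (mem_typicalOdd2_iff.mp hf).eq_false_of_weight_lt (by omega))
    (fun q f hf x hx => (mem_typicalOdd2_iff.mp hf).2.2.1 x (by omega))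
  have h := ((hT1.const_mul (1 / 2)).add (hT2.const_mul (1 / 2))).div
    ((tendsto_s1hat_div.add tendsto_s2hat_div).const_mul (1 / 2)) (by norm_num)
  norm_num at h
  refine h.congr fun q => ?_
  have hpos := (majoritySens_pos q).ne'
  rw [Pi.div_apply, ← add_div, mul_div_assoc', mul_div_assoc', mul_div_assoc', ← add_div,
    div_div_div_cancel_right₀ hpos]
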